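/- Let N be a positive integer, let a be an integer with 1 ≤ a ≤ N, and let r be a real number. Then there exists ε > 0 such that for all real u, v, w with |u|, |v|, |w| < ε and all complex numbers α₁, α₂, β₁, β₂ satisfying α₁+α₂ = u+vr, α₁α₂ = r(uv−w²), β₁+β₂ = −u+v(1−r), β₁β₂ = (r−1)(uv−w²), one has Σ_{k ≥ n+s, n ≥ s ≥ 1} X₀^r(k,n,s) u^{k−n−s} v^{n−s} w^{2s−2} = (1/((a−α₁)(a−α₂))) · ₃F₂((a+β₁)/N, (a+β₂)/N, 1; (a−α₁)/N + 1, (a−α₂)/N + 1; 1), where the left-hand side converges absolutely. -/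

import Mathlib

/-- All groupings of an index obtained by replacing each box in
`k₁ □ k₂ □ ⋯ □ kₙ` by a comma (new block) or a plus (merge). -/
def groupings : List ℕ → List (List ℕ)
  | [] => [[]]
  | [x] => [[x]]
  | x :: y :: rest => ((groupings (y :: rest)).map (x :: ·)) ++ groupings ((x + y) :: rest)
termination_by l => l.length

/-- Multiple t-value of level `N` with residue `a`:
`t_{N,a}(k) = Σ_{m₁ > ⋯ > mₙ > 0, mᵢ ≡ a (mod N)} 1/(m₁^{k₁} ⋯ mₙ^{kₙ})`. -/
noncomputable def tv (N a : ℕ) (k : List ℕ) : ℝ :=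
  ∑' m : {f : Fin k.length → ℕ // StrictAnti f ∧ ∀ i, 0 < f i ∧ f i % N = a % N},
    ∏ i : Fin k.length, ((m.1 i : ℝ) ^ k.get i)⁻¹

/-- Interpolated multiple t-value of level `N`:
`t^r_{N,a}(k) = Σ_p r^{n - dep(p)} t_{N,a}(p)` over all groupings `p` of `k`. -/
noncomputable def itv (N a : ℕ) (r : ℝ) (k : List ℕ) : ℝ :=
  ((groupings k).map (fun p => r ^ (k.length - p.length) * tv N a p)).sum

/-- An index is admissible if all entries are positive and the first entry is at least `2`. -/
def IsAdmissible (k : List ℕ) : Prop := (∀ i ∈ k, 1 ≤ i) ∧ 2 ≤ k.headI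

/-- The height of an index: the number of entries that are at least `2`. -/
def height (k : List ℕ) : ℕ := k.countP (fun i => 2 ≤ i)

/-- `X₀^r(k,n,s)`: sum of interpolated multiple t-values of level `N` over all
admissible indices of weight `k`, depth `n` and height `s`. -/
noncomputable def X0 (N a : ℕ) (r : ℝ) (k n s : ℕ) : ℝ :=
  ∑' l : {l : List ℕ // IsAdmissible l ∧ l.sum = k ∧ l.length = n ∧ height l = s},
    itv N a r l.1

/-- Rising factorial (Pochhammer symbol) `(b)ₙ = b(b+1)⋯(b+n-1)`. -/
noncomputable def poch {K : Type*} [RCLike K] (b : K) (n : ℕ) : K :=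
  ∏ i ∈ Finset.range n, (b + i)

/-- The generalized hypergeometric function
`F(b; c; z) = Σ_{n≥0} (b₁)ₙ⋯(bₚ)ₙ/((c₁)ₙ⋯(c_q)ₙ) · zⁿ/n!`. -/
noncomputable def genHyp {K : Type*} [RCLike K] (b c : List K) (z : K) : K :=
  ∑' n : ℕ, ((b.map fun x => poch x n).prod / (c.map fun x => poch x n).prod)
    * z ^ n / (n.factorial : K)

/-- Interpolated multiple sum over weakly decreasing sequences of positions bounded by `j`,
where consecutive equal positions, also with the bound itself, are weighted by `r`. -/
noncomputable def interpSum (e : ℕ → ℝ) (r : ℝ) : List ℕ → ℕ → ℝ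
  | [], _ => 1
  | x :: l, j => ∑ i ∈ Finset.range j, (e i ^ x)⁻¹ * interpSum e r l i
      + r * ((e j ^ x)⁻¹ * interpSum e r l j)

/-- The arithmetic progression `a, a + N, a + 2N, …`. -/
noncomputable def progression (N a : ℕ) (j : ℕ) : ℝ := (a : ℝ) + j * N

theorem succ_le_progression {N a : ℕ} (hN : 1 ≤ N) (ha : 1 ≤ a) (j : ℕ) :
    (j : ℝ) + 1 ≤ progression N a j := by
  have h1 : (1 : ℝ) ≤ N := by exact_mod_cast hN
  have h2 : (1 : ℝ) ≤ a := by exact_mod_cast ha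
  unfold progression
  nlinarith [(Nat.cast_nonneg j : (0 : ℝ) ≤ j)]

theorem interpSum_nonneg {e : ℕ → ℝ} (he : ∀ j, 0 ≤ e j) {r : ℝ} (hr : 0 ≤ r) (l : List ℕ) :
    ∀ j, 0 ≤ interpSum e r l j := by
  induction l with
  | nil => intro j; simp [interpSum]
  | cons x l ih =>
    intro j
    have h : ∀ i, 0 ≤ (e i ^ x)⁻¹ * interpSum e r l i :=
      fun i => mul_nonneg (inv_nonneg.2 (pow_nonneg (he i) x)) (ih i)
    exact add_nonneg (Finset.sum_nonneg fun i _ => h i) (mul_nonneg hr (h j))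

theorem abs_interpSum_le {e : ℕ → ℝ} (he : ∀ j, 0 ≤ e j) (r : ℝ) (l : List ℕ) :
    ∀ j, |interpSum e r l j| ≤ interpSum e |r| l j := by
  induction l with
  | nil => intro j; simp [interpSum]
  | cons x l ih =>
    intro j
    have h : ∀ i, |(e i ^ x)⁻¹ * interpSum e r l i| ≤ (e i ^ x)⁻¹ * interpSum e |r| l i := by
      intro i
      have h0 : 0 ≤ (e i ^ x)⁻¹ := inv_nonneg.2 (pow_nonneg (he i) x)
      rw [abs_mul, abs_of_nonneg h0]
      exact mul_le_mul_of_nonneg_left (ih i) h0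
    simp only [interpSum]
    refine (abs_add_le _ _).trans (add_le_add ((Finset.abs_sum_le_sum_abs _ _).trans
      (Finset.sum_le_sum fun i _ => h i)) ?_)
    rw [abs_mul]
    exact mul_le_mul_of_nonneg_left (h j) (abs_nonneg r)

theorem sum_sqrt_div_le (j : ℕ) :
    ∑ i ∈ Finset.range j, √((i : ℝ) + 1) / (i + 1) ≤ 2 * √(j : ℝ) := by
  induction j with
  | zero => simp
  | succ j ih =>
    rw [Finset.sum_range_succ]
    have hj : (0 : ℝ) ≤ j := Nat.cast_nonneg j
    have h1 : √((j : ℝ) + 1) ^ 2 = j + 1 := Real.sq_sqrt (by positivity)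
    have h2 : √(j : ℝ) ^ 2 = j := Real.sq_sqrt hj
    have h3 : 0 < √((j : ℝ) + 1) := Real.sqrt_pos.2 (by positivity)
    have h4 : √((j : ℝ) + 1) / (j + 1) = 1 / √((j : ℝ) + 1) := by
      rw [div_eq_div_iff (by positivity) h3.ne']
      nlinarith
    have h5 : 1 / √((j : ℝ) + 1) ≤ 2 * √((j : ℝ) + 1) - 2 * √(j : ℝ) := by
      rw [div_le_iff₀ h3]
      nlinarith [sq_nonneg (√((j : ℝ) + 1) - √(j : ℝ))]
    push_cast
    linarith

theorem inv_pow_le_inv {e : ℕ → ℝ} (he : ∀ j : ℕ, (j : ℝ) + 1 ≤ e j) {x : ℕ} (hx : 1 ≤ x) (j : ℕ) :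
    (e j ^ x)⁻¹ ≤ ((j : ℝ) + 1)⁻¹ := by
  have h1 : (0 : ℝ) < j + 1 := by positivity
  have h2 : (1 : ℝ) ≤ e j := by
    linarith [he j, (Nat.cast_nonneg j : (0 : ℝ) ≤ j)]
  exact inv_anti₀ h1 ((he j).trans (le_self_pow₀ h2 (by omega)))

theorem interpSum_zero_le {e : ℕ → ℝ} (he : ∀ j : ℕ, (j : ℝ) + 1 ≤ e j) (l : List ℕ)
    (hl : ∀ x ∈ l, 1 ≤ x) :
    ∀ j : ℕ, interpSum e 0 l j ≤ 2 ^ l.length * √((j : ℝ) + 1) := by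
  have he0 : ∀ j, 0 ≤ e j := fun j => le_trans (by positivity) (he j)
  induction l with
  | nil =>
    intro j
    simp [interpSum]
  | cons x l ih =>
    intro j
    have ih' := ih fun y hy => hl y (List.mem_cons_of_mem _ hy)
    have h : ∀ i ∈ Finset.range j, (e i ^ x)⁻¹ * interpSum e 0 l i
        ≤ 2 ^ l.length * (√((i : ℝ) + 1) / (i + 1)) := by
      intro i _
      calc (e i ^ x)⁻¹ * interpSum e 0 l i
          ≤ ((i : ℝ) + 1)⁻¹ * (2 ^ l.length * √((i : ℝ) + 1)) :=
            mul_le_mul (inv_pow_le_inv he (hl x List.mem_cons_self) i) (ih' i)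
              (interpSum_nonneg he0 le_rfl l i) (by positivity)
        _ = _ := by ring
    simp only [interpSum, zero_mul, add_zero, List.length_cons]
    refine (Finset.sum_le_sum h).trans ?_
    rw [← Finset.mul_sum, pow_succ, mul_assoc]
    refine mul_le_mul_of_nonneg_left ((sum_sqrt_div_le j).trans ?_) (by positivity)
    gcongr
    linarith

theorem summable_sqrt_div_sq :
    Summable fun j : ℕ => √((j : ℝ) + 1) / ((j : ℝ) + 1) ^ 2 := by
  have h : Summable fun j : ℕ => 1 / ((j : ℝ)) ^ (3 / 2 : ℝ) :=
    Real.summable_one_div_nat_rpow.2 (by norm_num)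
  refine ((summable_nat_add_iff 1).2 h).congr fun j => ?_
  have hj : (0 : ℝ) < j + 1 := by positivity
  push_cast
  rw [Real.sqrt_eq_rpow, ← Real.rpow_natCast, ← Real.rpow_sub hj, one_div, ← Real.rpow_neg hj.le]
  norm_num

theorem inv_pow_le_inv_sq {e : ℕ → ℝ} (he : ∀ j : ℕ, (j : ℝ) + 1 ≤ e j) {x : ℕ} (hx : 2 ≤ x) (j : ℕ) :
    (e j ^ x)⁻¹ ≤ (((j : ℝ) + 1) ^ 2)⁻¹ := by
  have h1 : (0 : ℝ) < j + 1 := by positivity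
  have h2 : (1 : ℝ) ≤ e j := by
    linarith [he j, (Nat.cast_nonneg j : (0 : ℝ) ≤ j)]
  exact inv_anti₀ (by positivity) ((pow_le_pow_left₀ h1.le (he j) 2).trans
    (pow_le_pow_right₀ h2 hx))

theorem summable_inv_pow_mul_interpSum_zero {e : ℕ → ℝ} (he : ∀ j : ℕ, (j : ℝ) + 1 ≤ e j) {x : ℕ}
    (hx : 2 ≤ x) {l : List ℕ} (hl : ∀ y ∈ l, 1 ≤ y) :
    Summable fun j => (e j ^ x)⁻¹ * interpSum e 0 l j := by
  have he0 : ∀ j, 0 ≤ e j := fun j => le_trans (by positivity) (he j)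
  refine Summable.of_nonneg_of_le
    (fun j => mul_nonneg (inv_nonneg.2 (pow_nonneg (he0 j) x)) (interpSum_nonneg he0 le_rfl l j))
    (fun j => ?_) (summable_sqrt_div_sq.mul_left (2 ^ l.length))
  calc (e j ^ x)⁻¹ * interpSum e 0 l j
      ≤ (((j : ℝ) + 1) ^ 2)⁻¹ * (2 ^ l.length * √((j : ℝ) + 1)) :=
        mul_le_mul (inv_pow_le_inv_sq he hx j) (interpSum_zero_le he l hl j)
          (interpSum_nonneg he0 le_rfl l j) (by positivity)
    _ = _ := by ring

theorem groupings_cons_cons (x y : ℕ) (l : List ℕ) :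
    groupings (x :: y :: l) = (groupings (y :: l)).map (x :: ·) ++ groupings ((x + y) :: l) := by
  rw [groupings]

theorem length_le_of_mem_groupings (l : List ℕ) :
    ∀ x, ∀ p ∈ groupings (x :: l), p.length ≤ l.length + 1 := by
  induction l with
  | nil => intro x p hp; simp_all [groupings]
  | cons y l ih =>
    intro x p hp
    rw [groupings_cons_cons, List.mem_append, List.mem_map] at hp
    rcases hp with ⟨q, hq, rfl⟩ | hp
    · simpa using ih y q hq
    · exact (ih _ p hp).trans (by simp)

theorem pos_of_mem_groupings (l : List ℕ) (hl : ∀ y ∈ l, 1 ≤ y) :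
    ∀ x, 1 ≤ x → ∀ p ∈ groupings (x :: l), ∀ y ∈ p, 1 ≤ y := by
  induction l with
  | nil => intro x hx p hp; simp_all [groupings]
  | cons y l ih =>
    intro x hx p hp
    have ih' := ih fun z hz => hl z (List.mem_cons_of_mem _ hz)
    have hy := hl y List.mem_cons_self
    rw [groupings_cons_cons, List.mem_append, List.mem_map] at hp
    rcases hp with ⟨q, hq, rfl⟩ | hp
    · intro z hz
      rcases List.mem_cons.1 hz with rfl | hz
      · exact hx
      · exact ih' y hy q hq z hz
    · exact ih' _ (by omega) p hp

theorem sum_groupings_cons_cons (r : ℝ) (f : List ℕ → ℝ) (x y : ℕ) (l : List ℕ) :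
    ((groupings (x :: y :: l)).map fun p => r ^ ((x :: y :: l).length - p.length) * f p).sum
      = ((groupings (y :: l)).map fun p => r ^ ((y :: l).length - p.length) * f (x :: p)).sum
        + r * ((groupings ((x + y) :: l)).map
          fun p => r ^ (((x + y) :: l).length - p.length) * f p).sum := by
  rw [groupings_cons_cons, List.map_append, List.sum_append, List.map_map, ← List.sum_map_mul_left]
  congr 1
  · congr 1
    refine List.map_congr_left fun p _ => ?_
    simp
  · congr 1
    refine List.map_congr_left fun p hp => ?_
    have := length_le_of_mem_groupings l _ p hp
    rw [← mul_assoc, ← pow_succ']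
    congr 2
    simp only [List.length_cons]
    omega

theorem sum_groupings_interpSum_zero {e : ℕ → ℝ} (r : ℝ) (l : List ℕ) :
    ∀ x j, ((groupings (x :: l)).map
      fun p => r ^ ((x :: l).length - p.length) * interpSum e 0 p j).sum
        = ∑ i ∈ Finset.range j, (e i ^ x)⁻¹ * interpSum e r l i := by
  induction l with
  | nil => intro x j; simp [groupings, interpSum]
  | cons y l ih =>
    intro x j
    rw [sum_groupings_cons_cons, ih]
    simp only [interpSum, zero_mul, add_zero]
    have h : ((groupings (y :: l)).map fun p => r ^ ((y :: l).length - p.length)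
        * ∑ i ∈ Finset.range j, (e i ^ x)⁻¹ * interpSum e 0 p i).sum
        = ∑ i ∈ Finset.range j, (e i ^ x)⁻¹ * ((groupings (y :: l)).map
          fun p => r ^ ((y :: l).length - p.length) * interpSum e 0 p i).sum := by
      generalize groupings (y :: l) = L
      induction L with
      | nil => simp
      | cons p L ih =>
        simp only [List.map_cons, List.sum_cons, ih, mul_add, Finset.sum_add_distrib]
        rw [Finset.mul_sum]
        congr 1
        exact Finset.sum_congr rfl fun i _ => by ring
    rw [h, Finset.mul_sum, ← Finset.sum_add_distrib]
    refine Finset.sum_congr rfl fun i _ => ?_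
    rw [ih, pow_add, mul_inv]
    ring

theorem mem_range_progression_iff {N a : ℕ} (hN : 1 ≤ N) (ha1 : 1 ≤ a) (ha2 : a ≤ N) (m : ℕ) :
    (0 < m ∧ m % N = a % N) ↔ m ∈ Set.range fun j : ℕ => a + j * N := by
  constructor
  · rintro ⟨h0, h⟩
    have ham : a ≤ m := by
      by_contra! hlt
      rw [Nat.mod_eq_of_lt (hlt.trans_le ha2)] at h
      rcases ha2.lt_or_eq with h1 | h1
      · rw [Nat.mod_eq_of_lt h1] at h; omega
      · rw [h1, Nat.mod_self] at h; omega
    obtain ⟨c, hc⟩ := (Nat.modEq_iff_dvd' ham).1 h.symm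
    exact ⟨c, by simp only; rw [mul_comm c N]; omega⟩
  · rintro ⟨j, rfl⟩
    exact ⟨by positivity, by simp⟩

/-- The multiple t-value sum as an extended nonnegative series over all functions, restricted to
those bounded by an arbitrary predicate. -/
noncomputable def tvBelow (N a : ℕ) (P : ℕ → Prop) (k : List ℕ) : ENNReal :=
  ∑' f : Fin k.length → ℕ, {f : Fin k.length → ℕ | (StrictAnti f ∧ ∀ i, 0 < f i ∧ f i % N = a % N)
    ∧ ∀ i, P (f i)}.indicator (fun f => ∏ i, ((f i : ENNReal) ^ k.get i)⁻¹) f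

theorem strictAnti_cons_iff {n m : ℕ} (g : Fin n → ℕ) :
    StrictAnti (Fin.cons m g : Fin (n + 1) → ℕ) ↔ StrictAnti g ∧ ∀ i, g i < m := by
  constructor
  · intro h
    refine ⟨fun i j hij => ?_, fun i => ?_⟩
    · simpa using h (Fin.succ_lt_succ_iff.2 hij)
    · simpa using h (Fin.succ_pos i)
  · rintro ⟨h1, h2⟩ i j hij
    induction j using Fin.cases with
    | zero => exact absurd hij (Fin.not_lt_zero i)
    | succ j =>
      induction i using Fin.cases with
      | zero => simpa using h2 j
      | succ i => simpa using h1 (Fin.succ_lt_succ_iff.1 hij)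

theorem tvBelow_cons {N a : ℕ} (P : ℕ → Prop) (hP : ∀ m m', m' < m → P m → P m') (x : ℕ)
    (l : List ℕ) :
    tvBelow N a P (x :: l) = ∑' m : ℕ, {m | (0 < m ∧ m % N = a % N) ∧ P m}.indicator
      (fun m => ((m : ENNReal) ^ x)⁻¹ * tvBelow N a (· < m) l) m := by
  classical
  unfold tvBelow
  refine ((Fin.consEquiv fun _ : Fin (l.length + 1) => ℕ).tsum_eq _).symm.trans ?_
  rw [ENNReal.tsum_prod']
  refine tsum_congr fun m => ?_
  by_cases hm : (0 < m ∧ m % N = a % N) ∧ P m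
  · rw [Set.indicator_of_mem (by exact hm), ← ENNReal.tsum_mul_left]
    refine tsum_congr fun g => ?_
    simp only [Set.indicator_apply, Set.mem_ofPred_eq]
    rw [mul_ite, mul_zero]
    refine if_congr ?_ ?_ rfl
    · change (StrictAnti (Fin.cons m g : Fin (l.length + 1) → ℕ) ∧ _) ∧ _ ↔ _
      rw [strictAnti_cons_iff]
      constructor
      · rintro ⟨⟨⟨h1, h2⟩, h3⟩, h4⟩
        exact ⟨⟨h1, fun i => h3 i.succ⟩, h2⟩
      · rintro ⟨⟨h1, h2⟩, h3⟩
        exact ⟨⟨⟨h1, h3⟩, fun i => Fin.cases hm.1 h2 i⟩,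
          fun i => Fin.cases hm.2 (fun i => hP _ _ (h3 i) hm.2) i⟩
    · exact Fin.prod_univ_succ (n := l.length) _
  · rw [Set.indicator_of_notMem (by exact hm), ENNReal.tsum_eq_zero]
    intro g
    refine Set.indicator_of_notMem ?_ _
    rintro ⟨⟨_, h1⟩, h2⟩
    exact hm ⟨h1 (0 : Fin (l.length + 1)), h2 (0 : Fin (l.length + 1))⟩

theorem tsum_indicator_progression {N a : ℕ} (hN : 1 ≤ N) (ha1 : 1 ≤ a) (ha2 : a ≤ N)
    (P : ℕ → Prop) (h : ℕ → ENNReal) :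
    ∑' m : ℕ, {m | (0 < m ∧ m % N = a % N) ∧ P m}.indicator h m
      = ∑' j : ℕ, {j | P (a + j * N)}.indicator (fun j => h (a + j * N)) j := by
  classical
  have hinj : Function.Injective fun j : ℕ => a + j * N := by
    intro i j hij
    have : i * N = j * N := by simpa using hij
    exact Nat.eq_of_mul_eq_mul_right hN this
  rw [← hinj.tsum_eq]
  · refine tsum_congr fun j => ?_
    have := (mem_range_progression_iff hN ha1 ha2 (a + j * N)).2 ⟨j, rfl⟩
    simp only [Set.indicator_apply, Set.mem_ofPred_eq, this, and_self, true_and]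
  · intro m hm
    by_contra hr
    exact hm (Set.indicator_of_notMem
      (fun hm' => hr ((mem_range_progression_iff hN ha1 ha2 m).1 hm'.1)) _)

theorem tvBelow_progression {N a : ℕ} (hN : 1 ≤ N) (ha1 : 1 ≤ a) (ha2 : a ≤ N) (l : List ℕ) :
    ∀ j : ℕ, tvBelow N a (· < a + j * N) l
      = ENNReal.ofReal (interpSum (progression N a) 0 l j) := by
  classical
  have he := succ_le_progression hN ha1
  have he0 : ∀ j, 0 < progression N a j := fun j => lt_of_lt_of_le (by positivity) (he j)
  induction l with
  | nil =>
    intro j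
    unfold tvBelow
    rw [tsum_eq_single (fun i => i.elim0) (fun b hb => (hb (funext fun i => i.elim0)).elim),
      Set.indicator_of_mem]
    · simp [interpSum]
    · exact ⟨⟨fun i => i.elim0, fun i => i.elim0⟩, fun i => i.elim0⟩
  | cons x l ih =>
    intro j
    rw [tvBelow_cons _ (fun m m' h1 h2 => h1.trans h2), tsum_indicator_progression hN ha1 ha2]
    rw [tsum_eq_sum (s := Finset.range j)]
    · simp only [interpSum, zero_mul, add_zero]
      rw [ENNReal.ofReal_sum_of_nonneg fun i _ =>
        mul_nonneg (by have := he0 i; positivity) (interpSum_nonneg (fun j => (he0 j).le) le_rfl l i)]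
      refine Finset.sum_congr rfl fun i hi => ?_
      rw [Set.indicator_of_mem, ih, ENNReal.ofReal_mul (by have := he0 i; positivity),
        ENNReal.ofReal_inv_of_pos (by have := he0 i; positivity),
        ENNReal.ofReal_pow (he0 i).le]
      · congr 3
        unfold progression
        rw [← ENNReal.ofReal_natCast]
        push_cast
        rfl
      · have := Finset.mem_range.1 hi
        simp only [Set.mem_ofPred_eq]
        gcongr
    · intro i hi
      refine Set.indicator_of_notMem ?_ _
      simp only [Set.mem_ofPred_eq, not_lt]
      have : j ≤ i := by simpa using hi
      gcongr

theorem tv_eq_toReal (N a : ℕ) (k : List ℕ) :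
    tv N a k = (tvBelow N a (fun _ => True) k).toReal := by
  classical
  unfold tv tvBelow
  simp only [implies_true, and_true]
  rw [← tsum_subtype {f : Fin k.length → ℕ | StrictAnti f ∧ ∀ i, 0 < f i ∧ f i % N = a % N},
    ENNReal.tsum_toReal_eq]
  · refine tsum_congr fun f => ?_
    rw [ENNReal.toReal_prod]
    simp
  · intro f
    refine ENNReal.prod_ne_top fun i _ => ENNReal.inv_ne_top.2 (pow_ne_zero _ ?_)
    exact_mod_cast (f.2.2 i).1.ne'

theorem tv_cons {N a : ℕ} (hN : 1 ≤ N) (ha1 : 1 ≤ a) (ha2 : a ≤ N) (x : ℕ) (l : List ℕ) :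
    tv N a (x :: l)
      = ∑' j, (progression N a j ^ x)⁻¹ * interpSum (progression N a) 0 l j := by
  have he := succ_le_progression hN ha1
  have he0 : ∀ j, 0 < progression N a j := fun j => lt_of_lt_of_le (by positivity) (he j)
  rw [tv_eq_toReal, tvBelow_cons _ (fun _ _ _ _ => trivial),
    tsum_indicator_progression hN ha1 ha2]
  simp only [Set.ofPred_true, Set.indicator_univ, tvBelow_progression hN ha1 ha2]
  rw [ENNReal.tsum_toReal_eq]
  · refine tsum_congr fun j => ?_
    rw [ENNReal.toReal_mul, ENNReal.toReal_ofReal (interpSum_nonneg (fun j => (he0 j).le) le_rfl l j)]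
    rw [ENNReal.toReal_inv, ENNReal.toReal_pow, ENNReal.toReal_natCast]
    push_cast [progression]
    rfl
  · intro j
    refine ENNReal.mul_ne_top (ENNReal.inv_ne_top.2 (pow_ne_zero _ ?_)) ENNReal.ofReal_ne_top
    exact_mod_cast (by positivity : 0 < a + j * N).ne'

theorem hasSum_itv_cons {N a : ℕ} (hN : 1 ≤ N) (ha1 : 1 ≤ a) (ha2 : a ≤ N) (r : ℝ) (l : List ℕ)
    (hl : ∀ y ∈ l, 1 ≤ y) :
    ∀ x, 2 ≤ x → HasSum (fun j => (progression N a j ^ x)⁻¹ * interpSum (progression N a) r l j)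
      (itv N a r (x :: l)) := by
  have he := succ_le_progression hN ha1
  have hasSum_tv : ∀ x, 2 ≤ x → ∀ p : List ℕ, (∀ y ∈ p, 1 ≤ y) → HasSum
      (fun j => (progression N a j ^ x)⁻¹ * interpSum (progression N a) 0 p j)
      (tv N a (x :: p)) := by
    intro x hx p hp
    rw [tv_cons hN ha1 ha2]
    exact (summable_inv_pow_mul_interpSum_zero he hx hp).hasSum
  induction l with
  | nil =>
    intro x hx
    simpa [itv, groupings, interpSum] using hasSum_tv x hx [] (by simp)
  | cons y l ih =>
    intro x hx
    have hy := hl y List.mem_cons_self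
    have hl' : ∀ z ∈ l, 1 ≤ z := fun z hz => hl z (List.mem_cons_of_mem _ hz)
    have h1 := (ih hl' (x + y) (by omega)).mul_left r
    have h2 : ∀ L : List (List ℕ), (∀ p ∈ L, ∀ z ∈ p, 1 ≤ z) → HasSum
        (fun j => (progression N a j ^ x)⁻¹ * (L.map fun p => r ^ ((y :: l).length - p.length)
          * interpSum (progression N a) 0 p j).sum)
        (L.map fun p => r ^ ((y :: l).length - p.length) * tv N a (x :: p)).sum := by
      intro L
      induction L with
      | nil => intro _; simp
      | cons p L ihL =>
        intro hL
        have h3 := ((hasSum_tv x hx p (hL p List.mem_cons_self)).mul_left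
          (r ^ ((y :: l).length - p.length))).add
            (ihL fun q hq => hL q (List.mem_cons_of_mem _ hq))
        simp only [List.map_cons, List.sum_cons]
        refine h3.congr_fun fun j => ?_
        ring
    have h4 := (h2 _ (pos_of_mem_groupings l hl' y hy)).add h1
    unfold itv at h4 ⊢
    rw [sum_groupings_cons_cons]
    refine h4.congr_fun fun j => ?_
    rw [sum_groupings_interpSum_zero, interpSum, pow_add, mul_inv]
    ring

/-- The weight of an entry of an index in the generating function. -/
def entryWeight (u v w : ℝ) : ℕ → ℝ
  | 0 => 0
  | 1 => v
  | k + 2 => u ^ k * w ^ 2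

/-- The weight of the leading entry of an index in the generating function. -/
def leadWeight (u : ℝ) : ℕ → ℝ
  | 0 => 0
  | 1 => 0
  | k + 2 => u ^ k

/-- The product of the weights of all entries. -/
def weightProd (u v w : ℝ) (l : List ℕ) : ℝ := (l.map (entryWeight u v w)).prod

/-- The weight of an index in the generating function; it vanishes if the index is not
admissible. -/
def indexWeight (u v w : ℝ) : List ℕ → ℝ
  | [] => 0
  | x :: l => leadWeight u x * weightProd u v w l

/-- The generating function of all entries placed at the point `e`. -/
noncomputable def entryGen (u v w e : ℝ) : ℝ := v / e + w ^ 2 / (e * (e - u))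

theorem weightProd_cons (u v w : ℝ) (x : ℕ) (l : List ℕ) :
    weightProd u v w (x :: l) = entryWeight u v w x * weightProd u v w l := by
  simp [weightProd]

theorem abs_entryWeight (u v w : ℝ) (x : ℕ) :
    |entryWeight u v w x| = entryWeight |u| |v| |w| x := by
  rcases x with _ | _ | x <;> simp [entryWeight, abs_mul, abs_pow]

theorem abs_leadWeight (u : ℝ) (x : ℕ) : |leadWeight u x| = leadWeight |u| x := by
  rcases x with _ | _ | x <;> simp [leadWeight, abs_pow]

theorem abs_weightProd (u v w : ℝ) (l : List ℕ) :
    |weightProd u v w l| = weightProd |u| |v| |w| l := by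
  induction l with
  | nil => simp [weightProd]
  | cons x l ih => rw [weightProd_cons, weightProd_cons, abs_mul, abs_entryWeight, ih]

theorem weightProd_eq_zero (u v w : ℝ) {l : List ℕ} (hl : ¬ ∀ y ∈ l, 1 ≤ y) :
    weightProd u v w l = 0 := by
  push Not at hl
  obtain ⟨y, hy, hy0⟩ := hl
  refine List.prod_eq_zero (List.mem_map.2 ⟨y, hy, ?_⟩)
  obtain rfl : y = 0 := by omega
  rfl

theorem hasSum_leadWeight {u e : ℝ} (h : |u| < e) :
    HasSum (fun x => leadWeight u x * (e ^ x)⁻¹) (1 / (e * (e - u))) := by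
  have he : 0 < e := (abs_nonneg u).trans_lt h
  have heu : 0 < e - u := sub_pos.2 ((le_abs_self u).trans_lt h)
  have h1 : |u / e| < 1 := by rwa [abs_div, abs_of_pos he, div_lt_one he]
  have h2 := (hasSum_geometric_of_abs_lt_one h1).mul_left (e ^ 2)⁻¹
  refine (hasSum_nat_add_iff' 2).1 ?_
  convert! h2 using 1
  · funext x
    simp only [leadWeight, div_pow, pow_add, mul_inv]
    ring
  · simp only [Finset.sum_range_succ, Finset.sum_range_zero, leadWeight]
    field_simp
    ring

theorem hasSum_entryWeight {u e : ℝ} (v w : ℝ) (h : |u| < e) :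
    HasSum (fun x => entryWeight u v w x * (e ^ x)⁻¹) (entryGen u v w e) := by
  have h1 := ((hasSum_leadWeight h).mul_left (w ^ 2)).add (hasSum_ite_eq 1 (v * e⁻¹))
  convert! h1 using 1
  · funext x
    rcases x with _ | _ | x
    · simp [entryWeight, leadWeight]
    · simp [entryWeight, leadWeight]
    · simp [entryWeight, leadWeight]
      ring
  · simp only [entryGen]
    ring

theorem entryGen_le {u v w e ε : ℝ} (hu0 : 0 ≤ u) (hw0 : 0 ≤ w) (hu : u < ε)
    (hv : v < ε) (hw : w < ε) (hε : ε ≤ 1 / 4) (he : 1 ≤ e) :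
    entryGen u v w e ≤ 2 * ε / e := by
  have h1 : w ^ 2 / (e * (e - u)) ≤ ε / e := by
    rw [div_le_div_iff₀ (mul_pos (by linarith) (by linarith)) (by linarith)]
    have h2 : w ^ 2 ≤ ε * (e - u) := by nlinarith
    nlinarith [mul_le_mul_of_nonneg_right h2 (by linarith : 0 ≤ e)]
  have h3 : v / e ≤ ε / e := by gcongr
  unfold entryGen
  calc _ ≤ ε / e + ε / e := add_le_add h3 h1
    _ = _ := by ring

theorem sum_weightProd_mul_interpSum_le {u v w r δ : ℝ} {e : ℕ → ℝ} (hu : 0 ≤ u) (hv : 0 ≤ v)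
    (hw : 0 ≤ w) (hr : 0 ≤ r) (hue : ∀ j, u < e j)
    (hδ : ∀ j : ℕ, entryGen u v w (e j) ≤ δ / (j + 1)) (hδr : δ * (2 + r) ≤ 1 / 2) (d : ℕ) :
    ∀ s : Finset (List ℕ), (∀ l ∈ s, l.length ≤ d) → ∀ j : ℕ,
      ∑ l ∈ s, weightProd u v w l * interpSum e r l j ≤ 2 * √((j : ℝ) + 1) := by
  have he0 : ∀ j, 0 ≤ e j := fun j => hu.trans (hue j).le
  have hW : ∀ l, 0 ≤ weightProd u v w l := fun l => by
    have := abs_weightProd u v w l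
    rw [abs_of_nonneg hu, abs_of_nonneg hv, abs_of_nonneg hw] at this
    exact this ▸ abs_nonneg _
  have hx : ∀ x, 0 ≤ entryWeight u v w x := fun x => by
    have := abs_entryWeight u v w x
    rw [abs_of_nonneg hu, abs_of_nonneg hv, abs_of_nonneg hw] at this
    exact this ▸ abs_nonneg _
  have hI := interpSum_nonneg he0 hr
  have hsqrt : ∀ j : ℕ, 1 ≤ √((j : ℝ) + 1) := fun j => by simp
  induction d with
  | zero =>
    intro s hs j
    have hsub : s ⊆ {[]} := fun l hl => by simpa using hs l hl
    refine (Finset.sum_le_sum_of_subset_of_nonneg hsub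
      fun l _ _ => mul_nonneg (hW l) (hI l j)).trans ?_
    simp only [Finset.sum_singleton, weightProd, interpSum, List.map_nil, List.prod_nil, mul_one]
    linarith [hsqrt j]
  | succ d ih =>
    intro s hs j
    classical
    set heads := s.image List.headI
    set tails := s.image List.tail
    have htails : ∀ l ∈ tails, l.length ≤ d := by
      intro l hl
      obtain ⟨l', hl', rfl⟩ := Finset.mem_image.1 hl
      have := hs l' hl'
      rw [List.length_tail]
      omega
    have hinj : Set.InjOn (fun p : ℕ × List ℕ => p.1 :: p.2)
        (heads ×ˢ tails : Finset (ℕ × List ℕ)) := by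
      rintro ⟨x, l⟩ _ ⟨x', l'⟩ _ h
      simpa using h
    have hsub : s ⊆ insert [] ((heads ×ˢ tails).image fun p => p.1 :: p.2) := by
      intro l hl
      rcases l with _ | ⟨x, l⟩
      · simp
      · refine Finset.mem_insert_of_mem (Finset.mem_image.2 ⟨(x, l), ?_, rfl⟩)
        exact Finset.mem_product.2 ⟨Finset.mem_image.2 ⟨_, hl, rfl⟩,
          Finset.mem_image.2 ⟨_, hl, rfl⟩⟩
    have hterm : ∀ i : ℕ, (∑ x ∈ heads, entryWeight u v w x * (e i ^ x)⁻¹)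
        * (∑ l ∈ tails, weightProd u v w l * interpSum e r l i)
        ≤ 2 * δ * (√((i : ℝ) + 1) / (i + 1)) := by
      intro i
      have h1 : ∑ x ∈ heads, entryWeight u v w x * (e i ^ x)⁻¹ ≤ δ / (i + 1) := by
        refine (sum_le_hasSum _ (fun x _ => ?_) (hasSum_entryWeight v w
          (by rw [abs_of_nonneg hu]; exact hue i))).trans (hδ i)
        exact mul_nonneg (hx x) (inv_nonneg.2 (pow_nonneg (he0 i) x))
      calc _ ≤ δ / (i + 1) * (2 * √((i : ℝ) + 1)) := by
            refine mul_le_mul h1 (ih tails htails i)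
              (Finset.sum_nonneg fun l _ => mul_nonneg (hW l) (hI l i)) ?_
            refine le_trans (Finset.sum_nonneg fun x _ => ?_) h1
            exact mul_nonneg (hx x) (inv_nonneg.2 (pow_nonneg (he0 i) x))
        _ = _ := by ring
    have hexp : ∑ p ∈ heads ×ˢ tails, weightProd u v w (p.1 :: p.2) * interpSum e r (p.1 :: p.2) j
        = ∑ i ∈ Finset.range j, (∑ x ∈ heads, entryWeight u v w x * (e i ^ x)⁻¹)
            * (∑ l ∈ tails, weightProd u v w l * interpSum e r l i)
          + r * ((∑ x ∈ heads, entryWeight u v w x * (e j ^ x)⁻¹)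
            * (∑ l ∈ tails, weightProd u v w l * interpSum e r l j)) := by
      have hprod : ∀ i, (∑ x ∈ heads, entryWeight u v w x * (e i ^ x)⁻¹)
          * (∑ l ∈ tails, weightProd u v w l * interpSum e r l i)
          = ∑ p ∈ heads ×ˢ tails, entryWeight u v w p.1 * (e i ^ p.1)⁻¹
            * (weightProd u v w p.2 * interpSum e r p.2 i) := fun i => by
        rw [Finset.sum_mul_sum, Finset.sum_product]
      simp only [hprod]
      rw [Finset.sum_comm, Finset.mul_sum, ← Finset.sum_add_distrib]
      refine Finset.sum_congr rfl fun p _ => ?_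
      rw [weightProd_cons, interpSum, mul_add, Finset.mul_sum]
      congr 1
      · exact Finset.sum_congr rfl fun i _ => by ring
      · ring
    have hδ0 : 0 ≤ δ := by
      have h0 : 0 ≤ entryGen u v w (e 0) := by
        have := hue 0
        have := he0 0
        unfold entryGen
        exact add_nonneg (by positivity) (div_nonneg (by positivity)
          (mul_nonneg this (by linarith)))
      simpa using h0.trans (hδ 0)
    have hlast : √((j : ℝ) + 1) / (j + 1) ≤ √((j : ℝ) + 1) :=
      div_le_self (Real.sqrt_nonneg _) (by linarith [(Nat.cast_nonneg j : (0 : ℝ) ≤ j)])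
    calc ∑ l ∈ s, weightProd u v w l * interpSum e r l j
        ≤ ∑ l ∈ insert [] ((heads ×ˢ tails).image fun p => p.1 :: p.2),
            weightProd u v w l * interpSum e r l j :=
          Finset.sum_le_sum_of_subset_of_nonneg hsub fun l _ _ => mul_nonneg (hW l) (hI l j)
      _ = 1 + (∑ i ∈ Finset.range j, (∑ x ∈ heads, entryWeight u v w x * (e i ^ x)⁻¹)
            * (∑ l ∈ tails, weightProd u v w l * interpSum e r l i)
          + r * ((∑ x ∈ heads, entryWeight u v w x * (e j ^ x)⁻¹)
            * (∑ l ∈ tails, weightProd u v w l * interpSum e r l j))) := by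
          rw [Finset.sum_insert (by simp), Finset.sum_image hinj, hexp]
          simp [weightProd, interpSum]
      _ ≤ 1 + (∑ i ∈ Finset.range j, 2 * δ * (√((i : ℝ) + 1) / (i + 1))
          + r * (2 * δ * (√((j : ℝ) + 1) / (j + 1)))) := by
          exact add_le_add le_rfl (add_le_add (Finset.sum_le_sum fun i _ => hterm i)
            (mul_le_mul_of_nonneg_left (hterm j) hr))
      _ ≤ 1 + (2 * δ * (2 * √((j : ℝ) + 1)) + r * (2 * δ * √((j : ℝ) + 1))) := by
          rw [← Finset.mul_sum]
          gcongr
          exact (sum_sqrt_div_le j).trans (by gcongr; linarith)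
      _ ≤ 2 * √((j : ℝ) + 1) := by
          nlinarith [hsqrt j, mul_le_mul_of_nonneg_right hδr (Real.sqrt_nonneg ((j : ℝ) + 1))]

theorem summable_and_tsum_abs_le {u v w r δ : ℝ} {e : ℕ → ℝ} (hue : ∀ j, |u| < e j)
    (hδ : ∀ j : ℕ, entryGen |u| |v| |w| (e j) ≤ δ / (j + 1)) (hδr : δ * (2 + |r|) ≤ 1 / 2)
    (j : ℕ) :
    Summable (fun l => |weightProd u v w l * interpSum e r l j|) ∧
      ∑' l, |weightProd u v w l * interpSum e r l j| ≤ 2 * √((j : ℝ) + 1) := by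
  have he0 : ∀ j, 0 ≤ e j := fun j => (abs_nonneg u).trans (hue j).le
  have h : ∀ s : Finset (List ℕ), ∑ l ∈ s, |weightProd u v w l * interpSum e r l j|
      ≤ 2 * √((j : ℝ) + 1) := by
    intro s
    refine le_trans (Finset.sum_le_sum fun l _ => ?_) (sum_weightProd_mul_interpSum_le
      (abs_nonneg u) (abs_nonneg v) (abs_nonneg w) (abs_nonneg r) hue hδ hδr (s.sup List.length) s
      (fun l hl => Finset.le_sup (f := List.length) hl) j)
    rw [abs_mul, abs_weightProd]
    exact mul_le_mul_of_nonneg_left (abs_interpSum_le he0 r l j) (abs_weightProd u v w l ▸ abs_nonneg _)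
  have hs := summable_of_sum_le (fun l => abs_nonneg _) h
  exact ⟨hs, hs.tsum_le_of_sum_le h⟩

theorem cons_injective_prod : Function.Injective fun p : ℕ × List ℕ => p.1 :: p.2 := by
  rintro ⟨x, l⟩ ⟨x', l'⟩ h
  simpa using h

theorem mem_range_cons {l : List ℕ} (hl : l ≠ []) :
    l ∈ Set.range fun p : ℕ × List ℕ => p.1 :: p.2 := by
  rcases l with _ | ⟨x, l⟩
  · exact absurd rfl hl
  · exact ⟨(x, l), rfl⟩

theorem tsum_list_eq {f : List ℕ → ℝ} (hf : Summable f) :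
    ∑' l, f l = f [] + ∑' p : ℕ × List ℕ, f (p.1 :: p.2) := by
  classical
  rw [hf.tsum_eq_add_tsum_ite [], ← cons_injective_prod.tsum_eq]
  · simp
  · intro l hl
    refine mem_range_cons fun h => hl ?_
    simp [h]

theorem hasSum_mul_prod {α β : Type*} {f : α → ℝ} {g : β → ℝ} {x y : ℝ} (hf : HasSum f x)
    (hg : HasSum g y) : HasSum (fun p : α × β => f p.1 * g p.2) (x * y) :=
  hf.mul hg (summable_mul_of_summable_norm hf.summable.norm hg.summable.norm)

theorem tsum_weightProd_recurrence {u v w r : ℝ} {e : ℕ → ℝ} (hue : ∀ j, |u| < e j)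
    (hF : ∀ j, Summable fun l => weightProd u v w l * interpSum e r l j) (j : ℕ) :
    ∑' l, weightProd u v w l * interpSum e r l j
      = 1 + ∑ i ∈ Finset.range j, entryGen u v w (e i)
          * (∑' l, weightProd u v w l * interpSum e r l i)
        + r * (entryGen u v w (e j) * ∑' l, weightProd u v w l * interpSum e r l j) := by
  have h : ∀ i, HasSum (fun p : ℕ × List ℕ => entryWeight u v w p.1 * (e i ^ p.1)⁻¹
      * (weightProd u v w p.2 * interpSum e r p.2 i))
      (entryGen u v w (e i) * ∑' l, weightProd u v w l * interpSum e r l i) :=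
    fun i => hasSum_mul_prod (hasSum_entryWeight v w (hue i)) (hF i).hasSum
  have h2 := (hasSum_sum (s := Finset.range j) fun i _ => h i).add ((h j).mul_left r)
  conv_lhs => rw [tsum_list_eq (hF j)]
  rw [add_assoc, ← h2.tsum_eq]
  congr 1
  · simp [weightProd, interpSum]
  · refine tsum_congr fun p => ?_
    rw [weightProd_cons, interpSum, mul_add, Finset.mul_sum]
    congr 1
    · exact Finset.sum_congr rfl fun i _ => by ring
    · ring

theorem hasSum_indexWeight_mul_itv {N a : ℕ} (hN : 1 ≤ N) (ha1 : 1 ≤ a) (ha2 : a ≤ N)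
    {u v w r δ : ℝ} (hu : |u| ≤ 1 / 2)
    (hδ : ∀ j : ℕ, entryGen |u| |v| |w| (progression N a j) ≤ δ / (j + 1))
    (hδr : δ * (2 + |r|) ≤ 1 / 2) :
    HasSum (fun l => indexWeight u v w l * itv N a r l)
      (∑' j, 1 / (progression N a j * (progression N a j - u))
        * ∑' l, weightProd u v w l * interpSum (progression N a) r l j) := by
  set e := progression N a
  have he := succ_le_progression hN ha1
  have he1 : ∀ j, 1 ≤ e j := fun j => by linarith [he j, (Nat.cast_nonneg j : (0 : ℝ) ≤ j)]
  have hue : ∀ j, |u| < e j := fun j => by linarith [he1 j]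
  have hF := fun j => summable_and_tsum_abs_le hue hδ hδr j
  have hfib : ∀ j, HasSum (fun p : ℕ × List ℕ => leadWeight u p.1 * (e j ^ p.1)⁻¹
      * (weightProd u v w p.2 * interpSum e r p.2 j))
      (1 / (e j * (e j - u)) * ∑' l, weightProd u v w l * interpSum e r l j) :=
    fun j => hasSum_mul_prod (hasSum_leadWeight (hue j)) (hF j).1.of_abs.hasSum
  have habs : ∀ j, HasSum (fun p : ℕ × List ℕ => |leadWeight u p.1 * (e j ^ p.1)⁻¹
      * (weightProd u v w p.2 * interpSum e r p.2 j)|)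
      (1 / (e j * (e j - |u|)) * ∑' l, |weightProd u v w l * interpSum e r l j|) := by
    intro j
    have h := hasSum_mul_prod (hasSum_leadWeight (u := |u|) (by rw [abs_abs]; exact hue j))
      (hF j).1.hasSum
    refine h.congr_fun fun p => ?_
    have : 0 ≤ (e j ^ p.1)⁻¹ := inv_nonneg.2 (pow_nonneg (by linarith [he1 j]) _)
    rw [abs_mul, abs_mul, abs_leadWeight, abs_of_nonneg this]
  have hsum : Summable fun q : ℕ × (ℕ × List ℕ) => leadWeight u q.2.1 * (e q.1 ^ q.2.1)⁻¹
      * (weightProd u v w q.2.2 * interpSum e r q.2.2 q.1) := by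
    refine Summable.of_abs ((summable_prod_of_nonneg fun _ => abs_nonneg _).2
      ⟨fun j => (habs j).summable, ?_⟩)
    refine Summable.of_nonneg_of_le (fun j => tsum_nonneg fun _ => abs_nonneg _) (fun j => ?_)
      (summable_sqrt_div_sq.mul_left 4)
    refine (habs j).tsum_eq.le.trans ?_
    have h1 : 1 / (e j * (e j - |u|)) ≤ 2 / ((j : ℝ) + 1) ^ 2 := by
      have hj : (0 : ℝ) < j + 1 := by positivity
      rw [div_le_div_iff₀ (mul_pos (by linarith [he1 j]) (by linarith [hue j])) (by positivity)]
      have h2 : ((j : ℝ) + 1) ^ 2 ≤ e j ^ 2 := pow_le_pow_left₀ hj.le (he j) 2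
      nlinarith [he1 j, mul_nonneg (by linarith [he1 j] : 0 ≤ e j) (by linarith [he1 j] :
        0 ≤ e j - 2 * |u|)]
    calc _ ≤ 2 / ((j : ℝ) + 1) ^ 2 * (2 * √((j : ℝ) + 1)) :=
          mul_le_mul h1 (hF j).2 (tsum_nonneg fun _ => abs_nonneg _) (by positivity)
      _ = _ := by ring
  have htotal := hsum.hasSum
  rw [← (htotal.prod_fiberwise hfib).tsum_eq] at htotal
  have hswap := ((Equiv.prodComm (ℕ × List ℕ) ℕ).hasSum_iff).2 htotal
  refine (cons_injective_prod.hasSum_iff fun l hl => ?_).1 (hswap.prod_fiberwise fun p => ?_)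
  · have : l = [] := by
      by_contra h
      exact hl (mem_range_cons h)
    simp [this, indexWeight]
  · obtain ⟨x, l⟩ := p
    simp only [Function.comp_apply, Equiv.prodComm_apply, Prod.swap_prod_mk, indexWeight]
    by_cases hl : ∀ y ∈ l, 1 ≤ y
    · rcases x with _ | _ | x
      · simp [leadWeight]
      · simp [leadWeight]
      · refine ((hasSum_itv_cons hN ha1 ha2 r l hl (x + 2) (by omega)).mul_left
          (leadWeight u (x + 2) * weightProd u v w l)).congr_fun fun j => ?_
        ring
    · simp [weightProd_eq_zero u v w hl]

theorem abs_entryGen_le {u v w e : ℝ} (h : |u| < e) :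
    |entryGen u v w e| ≤ entryGen |u| |v| |w| e := by
  have he : 0 < e := (abs_nonneg u).trans_lt h
  have h1 : 0 < e - |u| := sub_pos.2 h
  have h2 : e - |u| ≤ e - u := by linarith [le_abs_self u]
  unfold entryGen
  refine (abs_add_le _ _).trans (add_le_add ?_ ?_)
  · rw [abs_div, abs_of_pos he]
  · rw [abs_div, abs_mul, abs_of_pos he, abs_of_pos (h1.trans_le h2), abs_pow]
    gcongr

/-- The general term of the hypergeometric series in the Ohno–Zagier relation. -/
noncomputable def hypTerm (b c : List ℂ) (n : ℕ) : ℂ :=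
  ((b.map fun x => poch x n).prod / (c.map fun x => poch x n).prod) * 1 ^ n / (n.factorial : ℂ)

theorem hypTerm_succ (b₁ b₂ c₁ c₂ : ℂ) (n : ℕ) :
    hypTerm [b₁, b₂, 1] [c₁, c₂] (n + 1)
      = hypTerm [b₁, b₂, 1] [c₁, c₂] n * ((b₁ + n) * (b₂ + n) / ((c₁ + n) * (c₂ + n))) := by
  have hn : (1 + (n : ℂ)) * ((n : ℂ) + 1)⁻¹ = 1 := by
    rw [add_comm]
    exact mul_inv_cancel₀ (by exact_mod_cast n.succ_ne_zero)
  have hs : ∀ x : ℂ, poch x (n + 1) = poch x n * (x + n) := fun x => Finset.prod_range_succ _ _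
  simp only [hypTerm, List.map_cons, List.map_nil, List.prod_cons, List.prod_nil, hs, one_pow,
    Nat.factorial_succ, Nat.cast_mul, Nat.cast_succ, div_eq_mul_inv, mul_inv, mul_one]
  linear_combination (poch b₁ n * (b₁ + n) * (poch b₂ n * (b₂ + n) * poch 1 n)
    * ((poch c₁ n)⁻¹ * (c₁ + n)⁻¹ * ((poch c₂ n)⁻¹ * (c₂ + n)⁻¹)) * ((n.factorial : ℂ))⁻¹) * hn

theorem tsum_eq_genHyp {N a : ℕ} (hN : 1 ≤ N) (ha1 : 1 ≤ a) {u v w r : ℝ} {F : ℕ → ℝ}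
    (hu : |u| ≤ 1 / 2) (hr : ∀ j, 1 - r * entryGen u v w (progression N a j) ≠ 0)
    (hF : ∀ j, F j = 1 + ∑ i ∈ Finset.range j, entryGen u v w (progression N a i) * F i
        + r * (entryGen u v w (progression N a j) * F j))
    {α₁ α₂ β₁ β₂ : ℂ} (hα : α₁ + α₂ = (u : ℂ) + v * r)
    (hα' : α₁ * α₂ = (r : ℂ) * (u * v - w ^ 2)) (hβ : β₁ + β₂ = -(u : ℂ) + v * (1 - r))
    (hβ' : β₁ * β₂ = ((r : ℂ) - 1) * (u * v - w ^ 2)) :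
    ((∑' j, 1 / (progression N a j * (progression N a j - u)) * F j : ℝ) : ℂ)
      = 1 / (((a : ℂ) - α₁) * ((a : ℂ) - α₂)) *
            genHyp [((a : ℂ) + β₁) / N, ((a : ℂ) + β₂) / N, 1]
              [((a : ℂ) - α₁) / N + 1, ((a : ℂ) - α₂) / N + 1] 1 := by
  set e := progression N a
  have he : ∀ j, 0 < e j := fun j => lt_of_lt_of_le (by positivity) (succ_le_progression hN ha1 j)
  have heu : ∀ j, 0 < e j - u := fun j => by
    linarith [succ_le_progression hN ha1 j, le_abs_self u, (Nat.cast_nonneg j : (0 : ℝ) ≤ j)]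
  have hN0 : (N : ℂ) ≠ 0 := by exact_mod_cast (by omega : N ≠ 0)
  have hec : ∀ j, (e j : ℂ) = a + j * N := fun j => by simp [e, progression]
  set Q : ℕ → ℝ := fun j => 1 + ∑ i ∈ Finset.range j, entryGen u v w (e i) * F i
  set H := hypTerm [((a : ℂ) + β₁) / N, ((a : ℂ) + β₂) / N, 1]
    [((a : ℂ) - α₁) / N + 1, ((a : ℂ) - α₂) / N + 1]
  have hQF : ∀ j, (1 - r * entryGen u v w (e j)) * F j = Q j := fun j => by
    simp only [Q]
    linear_combination hF j
  have hX : ∀ j, entryGen u v w (e j) * (e j * (e j - u)) = v * (e j - u) + w ^ 2 := fun j => by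
    have := (he j).ne'
    have := (heu j).ne'
    unfold entryGen
    field_simp
  have hXc : ∀ j, (entryGen u v w (e j) : ℂ) * (e j * (e j - u)) = v * (e j - u) + w ^ 2 :=
    fun j => by exact_mod_cast hX j
  have hD : ∀ j, ((e j : ℂ) - α₁) * (e j - α₂)
      = ((e j * (e j - u) * (1 - r * entryGen u v w (e j)) : ℝ) : ℂ) := fun j => by
    push_cast
    linear_combination (-(e j : ℂ)) * hα + hα' + r * hXc j
  have hB : ∀ j, ((e j : ℂ) + β₁) * (e j + β₂)
      = ((e j * (e j - u) * (1 + (1 - r) * entryGen u v w (e j)) : ℝ) : ℂ) := fun j => by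
    push_cast
    linear_combination (e j : ℂ) * hβ + hβ' - (1 - r) * hXc j
  have hD0 : ∀ j, ((e j : ℂ) - α₁) * (e j - α₂) ≠ 0 := fun j => by
    rw [hD]
    exact_mod_cast mul_ne_zero (mul_pos (he j) (heu j)).ne' (hr j)
  have hQs : ∀ j, (Q (j + 1) : ℂ) * ((e j - α₁) * (e j - α₂))
      = Q j * ((e j + β₁) * (e j + β₂)) := fun j => by
    rw [hD, hB]
    norm_cast
    have h1 : Q (j + 1) = Q j + entryGen u v w (e j) * F j := by
      simp only [Q, Finset.sum_range_succ]
      ring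
    rw [h1, ← hQF]
    ring
  have hHs : ∀ j, H (j + 1) * ((e (j + 1) - α₁) * (e (j + 1) - α₂))
      = H j * ((e j + β₁) * (e j + β₂)) := fun j => by
    have hb : ∀ x : ℂ, ((a : ℂ) + x) / N + j = (e j + x) / N := fun x => by
      rw [hec]
      field_simp
      ring
    have hc : ∀ x : ℂ, ((a : ℂ) - x) / N + 1 + j = (e (j + 1) - x) / N := fun x => by
      rw [hec]
      push_cast
      field_simp
      ring
    have h1 := hD0 (j + 1)
    have h2 := left_ne_zero_of_mul h1
    have h3 := right_ne_zero_of_mul h1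
    simp only [H, hypTerm_succ, hb, hc]
    field_simp
  have hmain : ∀ j, H j * ((e j - α₁) * (e j - α₂))
      = Q j * (((a : ℂ) - α₁) * ((a : ℂ) - α₂)) := by
    intro j
    induction j with
    | zero => simp [H, hypTerm, Q, poch, hec]
    | succ j ih =>
      refine mul_right_cancel₀ (hD0 j) ?_
      rw [hHs]
      linear_combination ((e j : ℂ) + β₁) * (e j + β₂) * ih
        - (((a : ℂ) - α₁) * ((a : ℂ) - α₂)) * hQs j
  have ha0 : ((a : ℂ) - α₁) * ((a : ℂ) - α₂) ≠ 0 := by simpa [hec] using hD0 0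
  change _ = _ * ∑' j, H j
  rw [Complex.ofReal_tsum, ← tsum_mul_left]
  refine tsum_congr fun j => ?_
  have h1 : ((1 / (e j * (e j - u)) * F j : ℝ) : ℂ) = Q j / ((e j - α₁) * (e j - α₂)) := by
    rw [hD, ← hQF]
    norm_cast
    have := (he j).ne'
    have := (heu j).ne'
    have := hr j
    field_simp
  rw [h1, one_div_mul_eq_div, div_eq_div_iff (hD0 j) ha0, hmain]

theorem weightProd_eq_pow (u v w : ℝ) (l : List ℕ) (hl : ∀ y ∈ l, 1 ≤ y) :
    height l ≤ l.length ∧ l.length + height l ≤ l.sum ∧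
      weightProd u v w l
        = u ^ (l.sum - l.length - height l) * v ^ (l.length - height l) * w ^ (2 * height l) := by
  induction l with
  | nil => simp [height, weightProd]
  | cons x l ih =>
    obtain ⟨h1, h2, h3⟩ := ih fun y hy => hl y (List.mem_cons_of_mem _ hy)
    have hx := hl x List.mem_cons_self
    rcases x with _ | _ | x
    · omega
    · have hh : height (1 :: l) = height l := by simp [height]
      rw [zero_add, hh, weightProd_cons, h3, List.sum_cons, List.length_cons]
      refine ⟨by omega, by omega, ?_⟩
      rw [show 1 + l.sum - (l.length + 1) - height l = l.sum - l.length - height l by omega,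
        show l.length + 1 - height l = l.length - height l + 1 by omega,
        show entryWeight u v w 1 = v from rfl]
      ring
    · have hh : height ((x + 2) :: l) = height l + 1 := by simp [height]
      rw [add_assoc, one_add_one_eq_two, hh, weightProd_cons, h3, List.sum_cons, List.length_cons]
      refine ⟨by omega, by omega, ?_⟩
      rw [show x + 2 + l.sum - (l.length + 1) - (height l + 1)
          = x + (l.sum - l.length - height l) by omega,
        show l.length + 1 - (height l + 1) = l.length - height l by omega,
        show entryWeight u v w (x + 2) = u ^ x * w ^ 2 from rfl]
      ring

theorem indexWeight_eq_pow (u v w : ℝ) {l : List ℕ} (hl : IsAdmissible l) :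
    (l.length + height l ≤ l.sum ∧ height l ≤ l.length ∧ 1 ≤ height l) ∧
      indexWeight u v w l
        = u ^ (l.sum - l.length - height l) * v ^ (l.length - height l)
          * w ^ (2 * height l - 2) := by
  rcases l with _ | ⟨x, l⟩
  · simp [IsAdmissible] at hl
  · obtain ⟨hp, hx⟩ := hl
    obtain ⟨h1, h2, h3⟩ := weightProd_eq_pow u v w l fun y hy => hp y (List.mem_cons_of_mem _ hy)
    obtain ⟨x, rfl⟩ : ∃ x', x = x' + 2 := ⟨x - 2, by simp at hx; omega⟩
    have hh : height ((x + 2) :: l) = height l + 1 := by simp [height]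
    rw [hh, indexWeight, h3, List.sum_cons, List.length_cons]
    refine ⟨⟨by omega, by omega, by omega⟩, ?_⟩
    rw [show x + 2 + l.sum - (l.length + 1) - (height l + 1)
        = x + (l.sum - l.length - height l) by omega,
      show l.length + 1 - (height l + 1) = l.length - height l by omega,
      show 2 * (height l + 1) - 2 = 2 * height l by omega, leadWeight]
    ring

theorem indexWeight_eq_zero (u v w : ℝ) {l : List ℕ} (hl : ¬ IsAdmissible l) :
    indexWeight u v w l = 0 := by
  rcases l with _ | ⟨x, l⟩
  · rfl
  · rw [indexWeight]
    by_cases hp : ∀ y ∈ l, 1 ≤ y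
    · have hx : x < 2 := by
        by_contra! hx
        refine hl ⟨fun y hy => ?_, hx⟩
        rcases List.mem_cons.1 hy with rfl | hy
        · omega
        · exact hp y hy
      interval_cases x <;> simp [leadWeight]
    · rw [weightProd_eq_zero u v w hp, mul_zero]

theorem tsum_fiber_eq_X0_mul (N a : ℕ) (r u v w : ℝ) (p : ℕ × ℕ × ℕ) :
    ∑' l : (fun l : List ℕ => (l.sum, l.length, height l)) ⁻¹' {p},
        indexWeight u v w l * itv N a r l
      = if p.2.1 + p.2.2 ≤ p.1 ∧ p.2.2 ≤ p.2.1 ∧ 1 ≤ p.2.2 then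
          X0 N a r p.1 p.2.1 p.2.2 * u ^ (p.1 - p.2.1 - p.2.2) * v ^ (p.2.1 - p.2.2)
            * w ^ (2 * p.2.2 - 2)
        else 0 := by
  classical
  obtain ⟨k, n, s⟩ := p
  rw [tsum_subtype _ fun l => indexWeight u v w l * itv N a r l]
  have hX0 : X0 N a r k n s = ∑' l, {l : List ℕ | IsAdmissible l ∧ l.sum = k ∧ l.length = n ∧
      height l = s}.indicator (itv N a r) l :=
    tsum_subtype {l : List ℕ | IsAdmissible l ∧ l.sum = k ∧ l.length = n ∧ height l = s} _
  split_ifs with h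
  · rw [hX0, mul_assoc, mul_assoc, ← tsum_mul_right]
    refine tsum_congr fun l => ?_
    simp only [Set.indicator_apply, Set.mem_preimage, Set.mem_singleton_iff, Prod.mk.injEq,
      Set.mem_ofPred_eq]
    by_cases hl : IsAdmissible l
    · simp only [hl, true_and, ite_mul, zero_mul]
      refine if_ctx_congr Iff.rfl (fun hk => ?_) fun _ => rfl
      obtain ⟨rfl, rfl, rfl⟩ := hk
      rw [(indexWeight_eq_pow u v w hl).2]
      ring
    · simp [hl, indexWeight_eq_zero u v w hl]
  · rw [← tsum_zero]
    refine tsum_congr fun l => ?_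
    simp only [Set.indicator_apply, Set.mem_preimage, Set.mem_singleton_iff, Prod.mk.injEq]
    split_ifs with hk
    · obtain ⟨rfl, rfl, rfl⟩ := hk
      have hl : ¬ IsAdmissible l := fun hl => h (indexWeight_eq_pow u v w hl).1
      rw [indexWeight_eq_zero u v w hl, zero_mul]
    · rfl

/-- Theorem 2.1 (Ohno–Zagier type relation for interpolated multiple t-values of level `N`):
the generating function for the sums `X₀^r(k,n,s)` of interpolated multiple t-values of
level `N` with fixed weight, depth and height is given by a `₃F₂` evaluated at `1`. -/
theorem stmt0 (N : ℕ) (hN : 1 ≤ N) (a : ℕ) (ha1 : 1 ≤ a) (ha2 : a ≤ N) (r : ℝ) :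
    ∃ ε > (0 : ℝ), ∀ u v w : ℝ, |u| < ε → |v| < ε → |w| < ε →
      ∀ α₁ α₂ β₁ β₂ : ℂ,
        α₁ + α₂ = (u : ℂ) + v * r →
        α₁ * α₂ = (r : ℂ) * (u * v - w ^ 2) →
        β₁ + β₂ = -(u : ℂ) + v * (1 - r) →
        β₁ * β₂ = ((r : ℂ) - 1) * (u * v - w ^ 2) →
        Summable (fun p : ℕ × ℕ × ℕ =>
          if p.2.1 + p.2.2 ≤ p.1 ∧ p.2.2 ≤ p.2.1 ∧ 1 ≤ p.2.2 then
            X0 N a r p.1 p.2.1 p.2.2 * u ^ (p.1 - p.2.1 - p.2.2) * v ^ (p.2.1 - p.2.2)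
              * w ^ (2 * p.2.2 - 2)
          else 0) ∧
        ((∑' p : ℕ × ℕ × ℕ,
          if p.2.1 + p.2.2 ≤ p.1 ∧ p.2.2 ≤ p.2.1 ∧ 1 ≤ p.2.2 then
            X0 N a r p.1 p.2.1 p.2.2 * u ^ (p.1 - p.2.1 - p.2.2) * v ^ (p.2.1 - p.2.2)
              * w ^ (2 * p.2.2 - 2)
          else 0 : ℝ) : ℂ) =
          1 / (((a : ℂ) - α₁) * ((a : ℂ) - α₂)) *
            genHyp [((a : ℂ) + β₁) / N, ((a : ℂ) + β₂) / N, 1]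
              [((a : ℂ) - α₁) / N + 1, ((a : ℂ) - α₂) / N + 1] 1 := by
  have hr0 := abs_nonneg r
  have hε : 1 / (4 * (2 + |r|)) ≤ 1 / 4 := by
    gcongr
    linarith
  refine ⟨1 / (4 * (2 + |r|)), by positivity, ?_⟩
  intro u v w hu hv hw α₁ α₂ β₁ β₂ hα hα' hβ hβ'
  set ε := 1 / (4 * (2 + |r|)) with hεdef
  have hδr : 2 * ε * (2 + |r|) ≤ 1 / 2 := by
    rw [hεdef]
    field_simp
    norm_num
  have hε0 : 0 ≤ ε := by positivity
  have he := succ_le_progression hN ha1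
  have he1 : ∀ j, 1 ≤ progression N a j := fun j => by
    linarith [he j, (Nat.cast_nonneg j : (0 : ℝ) ≤ j)]
  have hue : ∀ j, |u| < progression N a j := fun j => by linarith [he1 j]
  have hδ : ∀ j : ℕ, entryGen |u| |v| |w| (progression N a j) ≤ 2 * ε / (j + 1) := fun j =>
    (entryGen_le (abs_nonneg u) (abs_nonneg w) hu hv hw hε (he1 j)).trans (by
      gcongr
      exact he j)
  have hr : ∀ j, 1 - r * entryGen u v w (progression N a j) ≠ 0 := fun j => by
    have h1 : |entryGen u v w (progression N a j)| ≤ 2 * ε :=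
      (abs_entryGen_le (hue j)).trans ((hδ j).trans (div_le_self (by positivity)
        (by linarith [(Nat.cast_nonneg j : (0 : ℝ) ≤ j)])))
    have h2 : |r * entryGen u v w (progression N a j)| ≤ |r| * (2 * ε) := by
      rw [abs_mul]
      gcongr
    have h3 := le_abs_self (r * entryGen u v w (progression N a j))
    nlinarith
  have hsum := (hasSum_indexWeight_mul_itv hN ha1 ha2 (by linarith) hδ hδr).tsum_fiberwise
    fun l : List ℕ => (l.sum, l.length, height l)
  simp only [tsum_fiber_eq_X0_mul] at hsum
  refine ⟨hsum.summable, ?_⟩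
  rw [hsum.tsum_eq]
  exact tsum_eq_genHyp hN ha1 (by linarith) hr (tsum_weightProd_recurrence hue
    fun j => (summable_and_tsum_abs_le hue hδ hδr j).1.of_abs) hα hα' hβ hβ'
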